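/- Let H = Σ_{w∈W} h_w where each h_w is Hermitian of operator norm at most 1 and supported on exactly k spins of a finite set C of N spins, with each spin contained in the support of at most g local terms. Let ρ be a product density matrix. Then for every real ε ≥ √(8e g³ k N), Tr(ρ Π_{≥ ⟨H⟩_ρ + ε}) ≤ exp(−ε²/(4e g³ k N)) and Tr(ρ Π_{≤ ⟨H⟩_ρ − ε}) ≤ exp(−ε²/(4e g³ k N)). -/

import Mathlib

open Matrix
open scoped ComplexOrder

variable {C : Type*} [Fintype C] [DecidableEq C] {d : ℕ}

/-- An operator on the spins `C` (each carrying `ℂ^d`) is *supported on* the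
subset `w ⊆ C` if it acts as the identity on the tensor factors outside `w`:
its matrix entries vanish unless the configurations agree outside `w`, and they
depend only on the configuration inside `w`. -/
def SupportedOn (w : Finset C) (M : Matrix (C → Fin d) (C → Fin d) ℂ) : Prop :=
  (∀ x y, M x y ≠ 0 → ∀ s ∉ w, x s = y s) ∧
  (∀ x y x' y', (∀ s ∈ w, x s = x' s) → (∀ s ∈ w, y s = y' s) →
    (∀ s ∉ w, x s = y s) → (∀ s ∉ w, x' s = y' s) → M x y = M x' y')

/-- The product operator `⊗_{s ∈ C} ρ_s` on `⊗_{s ∈ C} ℂ^d`. -/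
def prodMatrix (ρs : C → Matrix (Fin d) (Fin d) ℂ) :
    Matrix (C → Fin d) (C → Fin d) ℂ :=
  fun x y => ∏ s, ρs s (x s) (y s)

/-- Operator (spectral) norm of a matrix. -/
noncomputable def opNorm {m : Type*} [Fintype m] [DecidableEq m]
    (M : Matrix m m ℂ) : ℝ :=
  ‖Matrix.toEuclideanCLM (𝕜 := ℂ) M‖

/-- Spectral projector of a Hermitian matrix `H` onto eigenvalues ≥ `f`. -/
noncomputable def projGE {m : Type*} [Fintype m] [DecidableEq m]
    {H : Matrix m m ℂ} (hH : H.IsHermitian) (f : ℝ) : Matrix m m ℂ :=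
  (hH.eigenvectorUnitary : Matrix m m ℂ) *
    Matrix.diagonal (fun i => if f ≤ hH.eigenvalues i then (1 : ℂ) else 0) *
    (star hH.eigenvectorUnitary : Matrix m m ℂ)

/-- Spectral projector of a Hermitian matrix `H` onto eigenvalues ≤ `f`. -/
noncomputable def projLE {m : Type*} [Fintype m] [DecidableEq m]
    {H : Matrix m m ℂ} (hH : H.IsHermitian) (f : ℝ) : Matrix m m ℂ :=
  (hH.eigenvectorUnitary : Matrix m m ℂ) *
    Matrix.diagonal (fun i => if hH.eigenvalues i ≤ f then (1 : ℂ) else 0) *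
    (star hH.eigenvectorUnitary : Matrix m m ℂ)

section ProductState

open scoped Matrix.Norms.L2Operator

section State

variable {n : Type*} [Fintype n] [DecidableEq n]

open scoped MatrixOrder in
theorem exists_eq_conjTranspose_mul_self {M : Matrix n n ℂ} (hM : M.PosSemidef) :
    ∃ B : Matrix n n ℂ, M = Bᴴ * B :=
  CStarAlgebra.nonneg_iff_eq_star_mul_self.mp hM.nonneg

/-- The expectation value `M ↦ Tr(ρM)`. -/
noncomputable def expect (ρ : Matrix n n ℂ) : Matrix n n ℂ →ₗ[ℂ] ℂ :=
  Matrix.traceLinearMap n ℂ ℂ ∘ₗ LinearMap.mulLeft ℂ ρ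

theorem expect_apply (ρ M : Matrix n n ℂ) : expect ρ M = (ρ * M).trace := rfl

theorem norm_expect_le {ρ : Matrix n n ℂ} (hρ : ρ.PosSemidef) (htr : ρ.trace = 1)
    (M : Matrix n n ℂ) : ‖expect ρ M‖ ≤ ‖M‖ := by
  obtain ⟨B, rfl⟩ := exists_eq_conjTranspose_mul_self hρ
  let v : n → EuclideanSpace ℂ n := fun i => WithLp.toLp 2 (fun j => star (B i j))
  have hM : expect (Bᴴ * B) M = ∑ i, inner ℂ (v i) (Matrix.toEuclideanCLM (𝕜 := ℂ) M (v i)) := by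
    rw [expect_apply, Matrix.mul_assoc, Matrix.trace_mul_comm, Matrix.mul_assoc]
    refine Finset.sum_congr rfl fun i _ => ?_
    simp only [v, Matrix.toEuclideanCLM_toLp, EuclideanSpace.inner_toLp_toLp, Matrix.diag_apply]
    simp only [Matrix.mul_apply, dotProduct, Matrix.mulVec, Pi.star_apply,
      star_star, Matrix.conjTranspose_apply]
    refine Finset.sum_congr rfl fun j _ => ?_
    rw [mul_comm]
  have hv : ∑ i, ‖v i‖ ^ 2 = 1 := by
    have h1 : ((∑ i, ‖v i‖ ^ 2 : ℝ) : ℂ) = 1 := by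
      rw [← htr, Matrix.trace_mul_comm]
      push_cast
      refine Finset.sum_congr rfl fun i _ => ?_
      rw [← Complex.ofReal_pow, EuclideanSpace.norm_sq_eq]
      simp [v, Matrix.mul_apply, Complex.mul_conj, Complex.normSq_eq_norm_sq]
    exact_mod_cast h1
  rw [hM]
  calc ‖∑ i, inner ℂ (v i) (Matrix.toEuclideanCLM (𝕜 := ℂ) M (v i))‖
      ≤ ∑ i, ‖M‖ * ‖v i‖ ^ 2 := by
        refine (norm_sum_le _ _).trans (Finset.sum_le_sum fun i _ => ?_)
        refine (norm_inner_le_norm _ _).trans ?_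
        have := (Matrix.toEuclideanCLM (𝕜 := ℂ) M).le_opNorm (v i)
        rw [Matrix.cstar_norm_def]
        nlinarith [norm_nonneg (v i)]
    _ = ‖M‖ := by rw [← Finset.mul_sum, hv, mul_one]

theorem expect_im_eq_zero {ρ M : Matrix n n ℂ} (hρ : ρ.IsHermitian) (hM : M.IsHermitian) :
    (expect ρ M).im = 0 := by
  rw [← Complex.conj_eq_iff_im, expect_apply, starRingEnd_apply, ← Matrix.trace_conjTranspose,
    Matrix.conjTranspose_mul, hρ.eq, hM.eq, Matrix.trace_mul_comm]

/-- The probability that a measurement of `H` in its eigenbasis gives the `i`-th eigenvalue. -/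
noncomputable def spectralWeight (ρ : Matrix n n ℂ) {H : Matrix n n ℂ} (hH : H.IsHermitian)
    (i : n) : ℝ :=
  ((star hH.eigenvectorUnitary : Matrix n n ℂ) * ρ *
    (hH.eigenvectorUnitary : Matrix n n ℂ)) i i |>.re

variable {ρ H : Matrix n n ℂ}

theorem spectralWeight_nonneg (hρ : ρ.PosSemidef) (hH : H.IsHermitian) (i : n) :
    0 ≤ spectralWeight ρ hH i := by
  have := (hρ.conjTranspose_mul_mul_same (hH.eigenvectorUnitary : Matrix n n ℂ)).diag_nonneg
    (i := i)
  exact (Complex.le_def.mp this).1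

theorem ofReal_spectralWeight (hρ : ρ.PosSemidef) (hH : H.IsHermitian) (i : n) :
    (spectralWeight ρ hH i : ℂ) = ((star hH.eigenvectorUnitary : Matrix n n ℂ) * ρ *
      (hH.eigenvectorUnitary : Matrix n n ℂ)) i i := by
  have := (hρ.conjTranspose_mul_mul_same (hH.eigenvectorUnitary : Matrix n n ℂ)).diag_nonneg
    (i := i)
  exact Complex.ext rfl (Complex.le_def.mp this).2

theorem expect_conj_diagonal (hρ : ρ.PosSemidef) (hH : H.IsHermitian) (f : n → ℝ) :
    expect ρ ((hH.eigenvectorUnitary : Matrix n n ℂ) * Matrix.diagonal (fun i => (f i : ℂ)) *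
      (star hH.eigenvectorUnitary : Matrix n n ℂ)) =
      ((∑ i, spectralWeight ρ hH i * f i : ℝ) : ℂ) := by
  push_cast
  simp only [ofReal_spectralWeight hρ, expect_apply]
  rw [← Matrix.mul_assoc, Matrix.trace_mul_comm, ← Matrix.mul_assoc, ← Matrix.mul_assoc]
  simp [Matrix.trace, Matrix.mul_diagonal]

theorem sub_smul_one_pow_eq (hH : H.IsHermitian) (c : ℝ) (p : ℕ) :
    (H - (c : ℂ) • (1 : Matrix n n ℂ)) ^ p = (hH.eigenvectorUnitary : Matrix n n ℂ) *
      Matrix.diagonal (fun i => (((hH.eigenvalues i - c) ^ p : ℝ) : ℂ)) *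
      (star hH.eigenvectorUnitary : Matrix n n ℂ) := by
  set U : Matrix n n ℂ := (hH.eigenvectorUnitary : Matrix n n ℂ) with hU
  have h1 : star U * U = 1 := Unitary.coe_star_mul_self hH.eigenvectorUnitary
  have h2 : U * star U = 1 := Unitary.coe_mul_star_self hH.eigenvectorUnitary
  have hs : H = U * Matrix.diagonal (fun i => (hH.eigenvalues i : ℂ)) * star U := by
    conv_lhs => rw [hH.spectral_theorem, Unitary.conjStarAlgAut_apply]
    rfl
  have hc : H - (c : ℂ) • (1 : Matrix n n ℂ) =
      U * Matrix.diagonal (fun i => ((hH.eigenvalues i - c : ℝ) : ℂ)) * star U := by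
    have : Matrix.diagonal (fun i => ((hH.eigenvalues i - c : ℝ) : ℂ)) =
        Matrix.diagonal (fun i => (hH.eigenvalues i : ℂ)) - (c : ℂ) • (1 : Matrix n n ℂ) := by
      ext i j
      by_cases hij : i = j <;> simp [hij]
    rw [this, mul_sub, sub_mul, ← hs]
    simp [h2]
  change _ = U * _ * star U
  induction p with
  | zero => simp [h2]
  | succ p ih =>
    rw [pow_succ, ih, hc]
    have : ∀ D E : Matrix n n ℂ, U * D * star U * (U * E * star U) = U * (D * E) * star U := by
      intro D E
      calc U * D * star U * (U * E * star U) = U * D * (star U * U) * (E * star U) := by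
            simp only [Matrix.mul_assoc]
        _ = _ := by rw [h1]; simp only [Matrix.mul_assoc, Matrix.one_mul]
    rw [this, Matrix.diagonal_mul_diagonal]
    simp [pow_succ]

theorem expect_sub_smul_one_pow (hρ : ρ.PosSemidef) (hH : H.IsHermitian) (c : ℝ) (p : ℕ) :
    expect ρ ((H - (c : ℂ) • (1 : Matrix n n ℂ)) ^ p) =
      ((∑ i, spectralWeight ρ hH i * (hH.eigenvalues i - c) ^ p : ℝ) : ℂ) := by
  rw [sub_smul_one_pow_eq hH, expect_conj_diagonal hρ hH]

theorem sum_spectralWeight (hρ : ρ.PosSemidef) (htr : ρ.trace = 1) (hH : H.IsHermitian) :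
    ∑ i, spectralWeight ρ hH i = 1 := by
  have := expect_sub_smul_one_pow hρ hH 0 0
  simp only [pow_zero, mul_one, expect_apply, htr] at this
  exact_mod_cast this.symm

theorem trace_mul_projGE (hρ : ρ.PosSemidef) (hH : H.IsHermitian) (f : ℝ) :
    (ρ * projGE hH f).trace.re =
      ∑ i, spectralWeight ρ hH i * if f ≤ hH.eigenvalues i then 1 else 0 := by
  have := expect_conj_diagonal hρ hH (fun i => if f ≤ hH.eigenvalues i then 1 else 0)
  rw [← Complex.ofReal_re (∑ i, _), ← this, expect_apply, projGE]
  simp only [apply_ite Complex.ofReal, Complex.ofReal_one, Complex.ofReal_zero]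

theorem trace_mul_projLE (hρ : ρ.PosSemidef) (hH : H.IsHermitian) (f : ℝ) :
    (ρ * projLE hH f).trace.re =
      ∑ i, spectralWeight ρ hH i * if hH.eigenvalues i ≤ f then 1 else 0 := by
  have := expect_conj_diagonal hρ hH (fun i => if hH.eigenvalues i ≤ f then 1 else 0)
  rw [← Complex.ofReal_re (∑ i, _), ← this, expect_apply, projLE]
  simp only [apply_ite Complex.ofReal, Complex.ofReal_one, Complex.ofReal_zero]

theorem abs_eigenvalues_sub_le (hH : H.IsHermitian) (c : ℝ) (i : n) :
    |hH.eigenvalues i - c| ≤ ‖H - (c : ℂ) • (1 : Matrix n n ℂ)‖ := by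
  have h1 : Matrix.toEuclideanCLM (𝕜 := ℂ) (H - (c : ℂ) • (1 : Matrix n n ℂ))
      (hH.eigenvectorBasis i) = ((hH.eigenvalues i - c : ℝ) : ℂ) • hH.eigenvectorBasis i := by
    apply WithLp.ofLp_injective
    rw [Matrix.ofLp_toEuclideanCLM, Matrix.sub_mulVec, hH.mulVec_eigenvectorBasis,
      Matrix.smul_mulVec, Matrix.one_mulVec]
    ext j
    simp [sub_mul]
  have h2 := (Matrix.toEuclideanCLM (𝕜 := ℂ)
    (H - (c : ℂ) • (1 : Matrix n n ℂ))).le_opNorm (hH.eigenvectorBasis i)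
  rw [h1, norm_smul, hH.eigenvectorBasis.orthonormal.1 i, mul_one, mul_one, Complex.norm_real] at h2
  exact h2

end State

section Product

open scoped Kronecker

theorem prodMatrix_mul (A B : C → Matrix (Fin d) (Fin d) ℂ) :
    prodMatrix (fun s => A s * B s) = prodMatrix A * prodMatrix B := by
  ext x y
  simp only [prodMatrix, Matrix.mul_apply, Finset.prod_univ_sum, Fintype.piFinset_univ,
    Finset.prod_mul_distrib]

theorem prodMatrix_conjTranspose {C : Type*} [Fintype C] (A : C → Matrix (Fin d) (Fin d) ℂ) :
    prodMatrix (fun s => (A s)ᴴ) = (prodMatrix A)ᴴ := by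
  ext x y
  simp [prodMatrix, Matrix.conjTranspose_apply]

theorem posSemidef_prodMatrix {ρs : C → Matrix (Fin d) (Fin d) ℂ}
    (hρs : ∀ s, (ρs s).PosSemidef) : (prodMatrix ρs).PosSemidef := by
  choose B hB using fun s => exists_eq_conjTranspose_mul_self (hρs s)
  rw [funext hB, prodMatrix_mul, prodMatrix_conjTranspose]
  exact Matrix.posSemidef_conjTranspose_mul_self _

theorem trace_prodMatrix (A : C → Matrix (Fin d) (Fin d) ℂ) :
    (prodMatrix A).trace = ∏ s, (A s).trace := by
  simp only [Matrix.trace, Matrix.diag_apply, prodMatrix, Finset.prod_univ_sum,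
    Fintype.piFinset_univ]

/-- Splitting a configuration into its parts inside and outside `w`. -/
def splitEquiv (w : Finset C) :
    (C → Fin d) ≃ ({s // s ∈ w} → Fin d) × ({s // s ∉ w} → Fin d) :=
  Equiv.piEquivPiSubtypeProd (· ∈ w) fun _ => Fin d

theorem SupportedOn.exists_eq_kronecker_one {w : Finset C}
    {M : Matrix (C → Fin d) (C → Fin d) ℂ} (hM : SupportedOn w M) :
    ∃ m : Matrix ({s // s ∈ w} → Fin d) ({s // s ∈ w} → Fin d) ℂ,
      M = (m ⊗ₖ (1 : Matrix ({s // s ∉ w} → Fin d) ({s // s ∉ w} → Fin d) ℂ)).submatrix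
        (splitEquiv w) (splitEquiv w) := by
  rcases isEmpty_or_nonempty (C → Fin d) with _ | ⟨⟨x₀⟩⟩
  · exact ⟨0, Subsingleton.elim _ _⟩
  refine ⟨fun a b => M ((splitEquiv w).symm (a, ((splitEquiv w) x₀).2))
    ((splitEquiv w).symm (b, ((splitEquiv w) x₀).2)), ?_⟩
  ext x y
  change M x y = M _ _ * (1 : Matrix ({s // s ∉ w} → Fin d) _ ℂ) ((splitEquiv w) x).2
    ((splitEquiv w) y).2
  rw [Matrix.one_apply]
  split_ifs with hxy
  · rw [mul_one]
    refine hM.2 _ _ _ _ ?_ ?_ ?_ ?_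
    · intro s hs; simp [splitEquiv, Equiv.piEquivPiSubtypeProd, hs]
    · intro s hs; simp [splitEquiv, Equiv.piEquivPiSubtypeProd, hs]
    · intro s hs; exact congrFun hxy ⟨s, hs⟩
    · intro s hs; simp [splitEquiv, Equiv.piEquivPiSubtypeProd, hs]
  · rw [mul_zero]
    by_contra hne
    exact hxy (funext fun s => hM.1 x y hne s s.2)

/-- The algebra of operators acting trivially on the spins in `w`. -/
def outsideAlgebra (w : Finset C) : Subalgebra ℂ (Matrix (C → Fin d) (C → Fin d) ℂ) where
  carrier := {M | ∃ m : Matrix ({s // s ∉ w} → Fin d) ({s // s ∉ w} → Fin d) ℂ,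
    M = ((1 : Matrix ({s // s ∈ w} → Fin d) ({s // s ∈ w} → Fin d) ℂ) ⊗ₖ m).submatrix
      (splitEquiv w) (splitEquiv w)}
  mul_mem' := by
    rintro _ _ ⟨a, rfl⟩ ⟨b, rfl⟩
    exact ⟨a * b, by rw [Matrix.submatrix_mul_equiv, ← Matrix.mul_kronecker_mul, mul_one]⟩
  add_mem' := by
    rintro _ _ ⟨a, rfl⟩ ⟨b, rfl⟩
    exact ⟨a + b, by rw [Matrix.kronecker_add]; rfl⟩
  algebraMap_mem' c := ⟨c • 1, by
    rw [Matrix.kronecker_smul, Matrix.one_kronecker_one, Algebra.algebraMap_eq_smul_one,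
      Matrix.submatrix_smul, Pi.smul_apply, Pi.smul_apply, Matrix.submatrix_one_equiv]⟩

theorem SupportedOn.mem_outsideAlgebra {v w : Finset C}
    {M : Matrix (C → Fin d) (C → Fin d) ℂ} (hM : SupportedOn v M) (hvw : Disjoint v w) :
    M ∈ outsideAlgebra (d := d) w := by
  rcases isEmpty_or_nonempty (C → Fin d) with _ | ⟨⟨x₀⟩⟩
  · exact ⟨0, Subsingleton.elim _ _⟩
  refine ⟨fun a b => M ((splitEquiv w).symm (((splitEquiv w) x₀).1, a))
    ((splitEquiv w).symm (((splitEquiv w) x₀).1, b)), ?_⟩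
  have hout : ∀ s ∈ v, s ∉ w := fun s hs => Finset.disjoint_left.mp hvw hs
  ext x y
  change M x y = (1 : Matrix ({s // s ∈ w} → Fin d) _ ℂ) ((splitEquiv w) x).1
    ((splitEquiv w) y).1 * M _ _
  rw [Matrix.one_apply]
  split_ifs with hxy
  · rw [one_mul]
    have hin : ∀ s ∈ w, x s = y s := fun s hs => congrFun hxy ⟨s, hs⟩
    set x' := (splitEquiv w).symm (((splitEquiv w) x₀).1, ((splitEquiv w) x).2) with hx'
    set y' := (splitEquiv w).symm (((splitEquiv w) x₀).1, ((splitEquiv w) y).2) with hy'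
    have hxx : ∀ s ∉ w, x s = x' s := by
      intro s hs; simp [hx', splitEquiv, Equiv.piEquivPiSubtypeProd, hs]
    have hyy : ∀ s ∉ w, y s = y' s := by
      intro s hs; simp [hy', splitEquiv, Equiv.piEquivPiSubtypeProd, hs]
    have hxy' : ∀ s ∈ w, x' s = y' s := by
      intro s hs; simp [hx', hy', splitEquiv, Equiv.piEquivPiSubtypeProd, hs]
    have hiff : (∀ s ∉ v, x s = y s) ↔ ∀ s ∉ v, x' s = y' s := by
      refine forall₂_congr fun s hs => ?_
      by_cases hsw : s ∈ w
      · simp [hin s hsw, hxy' s hsw]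
      · rw [hxx s hsw, hyy s hsw]
    by_cases hoff : ∀ s ∉ v, x s = y s
    · exact hM.2 _ _ _ _ (fun s hs => hxx s (hout s hs)) (fun s hs => hyy s (hout s hs))
        hoff (hiff.mp hoff)
    · rw [not_not.mp (mt (hM.1 x y) hoff), not_not.mp (mt (hM.1 x' y') (mt hiff.mpr hoff))]
  · rw [zero_mul]
    by_contra hne
    exact hxy (funext fun s => hM.1 x y hne s fun hs => hout s hs s.2)

theorem prodMatrix_eq_kronecker (ρs : C → Matrix (Fin d) (Fin d) ℂ) (w : Finset C) :
    prodMatrix ρs = (prodMatrix (fun s : {s // s ∈ w} => ρs s) ⊗ₖ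
      prodMatrix (fun s : {s // s ∉ w} => ρs s)).submatrix (splitEquiv w) (splitEquiv w) := by
  ext x y
  change _ = (∏ s : {s // s ∈ w}, ρs s (x s) (y s)) * ∏ s : {s // s ∉ w}, ρs s (x s) (y s)
  convert (Fintype.prod_subtype_mul_prod_subtype (· ∈ w) fun s => ρs s (x s) (y s)).symm
  rfl

variable {w : Finset C} {M A : Matrix (C → Fin d) (C → Fin d) ℂ}

theorem SupportedOn.commute (hM : SupportedOn w M) (hA : A ∈ outsideAlgebra (d := d) w) :
    Commute M A := by
  obtain ⟨m, rfl⟩ := hM.exists_eq_kronecker_one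
  obtain ⟨a, rfl⟩ := hA
  rw [Commute, SemiconjBy, Matrix.submatrix_mul_equiv, Matrix.submatrix_mul_equiv,
    ← Matrix.mul_kronecker_mul, ← Matrix.mul_kronecker_mul]
  simp only [mul_one, one_mul]

theorem Matrix.trace_submatrix_equiv {m n : Type*} [Fintype m] [Fintype n] (e : m ≃ n)
    (A : Matrix n n ℂ) : (A.submatrix e e).trace = A.trace :=
  e.sum_comp fun i => A i i

theorem SupportedOn.expect_pow_mul {ρs : C → Matrix (Fin d) (Fin d) ℂ}
    (hρs : ∀ s, (ρs s).trace = 1) (hM : SupportedOn w M) (hA : A ∈ outsideAlgebra (d := d) w)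
    (p : ℕ) :
    expect (prodMatrix ρs) (M ^ p * A) =
      expect (prodMatrix ρs) (M ^ p) * expect (prodMatrix ρs) A := by
  obtain ⟨m, rfl⟩ := hM.exists_eq_kronecker_one
  obtain ⟨a, rfl⟩ := hA
  have hpow : (m ⊗ₖ (1 : Matrix ({s // s ∉ w} → Fin d) ({s // s ∉ w} → Fin d) ℂ)).submatrix
      (splitEquiv w) (splitEquiv w) ^ p =
      ((m ^ p) ⊗ₖ (1 : Matrix ({s // s ∉ w} → Fin d) ({s // s ∉ w} → Fin d) ℂ)).submatrix
        (splitEquiv w) (splitEquiv w) := by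
    induction p with
    | zero => rw [pow_zero, pow_zero, Matrix.one_kronecker_one, Matrix.submatrix_one_equiv]
    | succ p ih =>
      rw [pow_succ, ih, Matrix.submatrix_mul_equiv, ← Matrix.mul_kronecker_mul, mul_one, pow_succ]
  simp only [hpow, expect_apply, prodMatrix_eq_kronecker ρs w, Matrix.submatrix_mul_equiv,
    ← Matrix.mul_kronecker_mul, mul_one, one_mul, Matrix.trace_submatrix_equiv,
    Matrix.trace_kronecker, trace_prodMatrix, hρs, Finset.prod_const_one]

theorem SupportedOn.sub_smul_one (hM : SupportedOn w M) (c : ℂ) :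
    SupportedOn w (M - c • (1 : Matrix (C → Fin d) (C → Fin d) ℂ)) := by
  refine ⟨fun x y hxy s hs => ?_, fun x y x' y' hx hy hxy hxy' => ?_⟩
  · by_cases h : x = y
    · rw [h]
    · refine hM.1 x y ?_ s hs
      simpa [Matrix.one_apply, h] using hxy
  · have hiff : x = y ↔ x' = y' := by
      simp only [funext_iff]
      refine forall_congr' fun s => ?_
      by_cases hs : s ∈ w
      · rw [hx s hs, hy s hs]
      · simp [hxy s hs, hxy' s hs]
    simp only [Matrix.sub_apply, Matrix.smul_apply, Matrix.one_apply, hM.2 x y x' y' hx hy hxy hxy',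
      hiff]

end Product

section Counting

/-- A finite graph without isolated vertices has a dominating set of at most half its size. -/
theorem exists_dominating_finset {V : Type*} [Fintype V] [DecidableEq V] (R : V → V → Prop)
    (hsymm : ∀ i j, R i j → R j i) (hR : ∀ i, ∃ j, j ≠ i ∧ R i j) :
    ∃ S : Finset V, 2 * S.card ≤ Fintype.card V ∧ ∀ i ∉ S, ∃ j ∈ S, R i j := by
  obtain ⟨S, -, hS⟩ := exists_minimal_le_of_wellFoundedLT
    (fun S : Finset V => ∀ i ∉ S, ∃ j ∈ S, R i j) Finset.univ (by simp)
  have hcompl : ∀ i ∉ Sᶜ, ∃ j ∈ Sᶜ, R i j := by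
    intro v hv
    rw [Finset.mem_compl, not_not] at hv
    by_contra! hno
    have hnbr : ∀ j, R v j → j ∈ S := fun j hj => by
      by_contra hjS
      exact hno j (Finset.mem_compl.mpr hjS) hj
    have hdom : ∀ i ∉ S.erase v, ∃ j ∈ S.erase v, R i j := by
      intro i hi
      by_cases hiv : i = v
      · obtain ⟨j, hj, hij⟩ := hR v
        exact ⟨j, Finset.mem_erase.mpr ⟨hj, hnbr j hij⟩, hiv ▸ hij⟩
      · have hiS : i ∉ S := fun h => hi (Finset.mem_erase.mpr ⟨hiv, h⟩)
        obtain ⟨j, hj, hij⟩ := hS.prop i hiS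
        refine ⟨j, Finset.mem_erase.mpr ⟨?_, hj⟩, hij⟩
        rintro rfl
        exact hiS (hnbr i (hsymm _ _ hij))
    exact absurd (hS.le_of_le hdom (Finset.erase_subset v S) hv) (Finset.notMem_erase v S)
  have hcard := Finset.card_compl_add_card S
  rcases le_total S.card Sᶜ.card with h | h
  · exact ⟨S, by omega, hS.prop⟩
  · exact ⟨Sᶜ, by omega, hcompl⟩

variable {ι : Type*} [Fintype ι] [DecidableEq ι]

theorem card_filter_dominated_le (R : ι → ι → Prop) [DecidableRel R] {m : ℕ}
    (hm : ∀ a, (Finset.univ.filter (R a)).card ≤ m) {V : Type*} [Fintype V] [DecidableEq V]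
    (S : Finset V) :
    (Finset.univ.filter fun f : V → ι => ∀ i ∉ S, ∃ j ∈ S, R (f j) (f i)).card ≤
      (S.card * m) ^ (Fintype.card V - S.card) * Fintype.card ι ^ S.card := by
  set T := Finset.univ.filter fun f : V → ι => ∀ i ∉ S, ∃ j ∈ S, R (f j) (f i)
  let res : (V → ι) → ({i // i ∈ S} → ι) := fun f i => f i
  have himg : (T.image res).card ≤ Fintype.card ι ^ S.card := by
    refine (Finset.card_le_univ _).trans ?_
    simp
  refine (Finset.card_le_mul_card_image (f := res) T
    ((S.card * m) ^ (Fintype.card V - S.card)) fun a _ => ?_).trans (by gcongr)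
  let nbhd : Finset ι := Finset.univ.biUnion fun j : {i // i ∈ S} => Finset.univ.filter (R (a j))
  have hnbhd : nbhd.card ≤ S.card * m := by
    refine Finset.card_biUnion_le.trans ((Finset.sum_le_card_nsmul _ _ m fun j _ => hm _).trans ?_)
    simp
  have hpi : (Fintype.piFinset fun _ : {i // i ∉ S} => nbhd).card ≤
      (S.card * m) ^ (Fintype.card V - S.card) := by
    rw [Fintype.card_piFinset, Finset.prod_const, Finset.card_univ, Fintype.card_subtype_compl,
      Fintype.card_coe]
    gcongr
  refine (Finset.card_le_card_of_injOn (fun f (i : {i // i ∉ S}) => f i) ?_ ?_).trans hpi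
  · intro f hf
    rw [Finset.mem_coe, Finset.mem_filter, Finset.mem_filter] at hf
    obtain ⟨⟨-, hf⟩, rfl⟩ := hf
    simp only [Finset.mem_coe, Fintype.mem_piFinset]
    intro i
    obtain ⟨j, hj, hij⟩ := hf i i.2
    exact Finset.mem_biUnion.mpr ⟨⟨j, hj⟩, Finset.mem_univ _, by simpa [res] using hij⟩
  · intro f hf f' hf' heq
    have h1 : res f = res f' := by
      rw [(Finset.mem_filter.mp hf).2, (Finset.mem_filter.mp hf').2]
    funext i
    by_cases hi : i ∈ S
    · exact congrFun h1 ⟨i, hi⟩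
    · exact congrFun heq ⟨i, hi⟩

theorem card_filter_no_isolated_le (R : ι → ι → Prop) [DecidableRel R]
    (hsymm : ∀ a b, R a b → R b a) {m : ℕ}
    (hm : ∀ a, (Finset.univ.filter (R a)).card ≤ m) (r : ℕ) :
    (Finset.univ.filter fun f : Fin (2 * r) → ι => ∀ i, ∃ j, j ≠ i ∧ R (f i) (f j)).card ≤
      r.centralBinom * (Fintype.card ι * (r * m)) ^ r := by
  have hsub : (Finset.univ.filter fun f : Fin (2 * r) → ι => ∀ i, ∃ j, j ≠ i ∧ R (f i) (f j)) ⊆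
      (Finset.univ.powersetCard r).biUnion fun S =>
        Finset.univ.filter fun f : Fin (2 * r) → ι => ∀ i ∉ S, ∃ j ∈ S, R (f j) (f i) := by
    intro f hf
    obtain ⟨S, hS, hdom⟩ := exists_dominating_finset (fun i j => R (f i) (f j))
      (fun i j => hsymm _ _) (Finset.mem_filter.mp hf).2
    rw [Fintype.card_fin] at hS
    obtain ⟨S', hSS', hS'⟩ := Finset.exists_superset_card_eq (s := S) (n := r) (by omega)
      (by rw [Fintype.card_fin]; omega)
    refine Finset.mem_biUnion.mpr ⟨S', by simp [Finset.mem_powersetCard, hS'], ?_⟩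
    refine Finset.mem_filter.mpr ⟨Finset.mem_univ _, fun i hi => ?_⟩
    obtain ⟨j, hj, hij⟩ := hdom i fun h => hi (hSS' h)
    exact ⟨j, hSS' hj, hsymm _ _ hij⟩
  refine (Finset.card_le_card hsub).trans (Finset.card_biUnion_le.trans ?_)
  refine (Finset.sum_le_card_nsmul _ _ ((Fintype.card ι * (r * m)) ^ r) fun S hS => ?_).trans ?_
  · have h := card_filter_dominated_le R hm S
    rw [(Finset.mem_powersetCard.mp hS).2, Fintype.card_fin, show 2 * r - r = r by omega,
      mul_comm ((r * m) ^ r),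
      ← mul_pow] at h
    refine le_of_eq_of_le ?_ h
    congr
  · simp [Nat.centralBinom]

end Counting

section Moments

theorem sum_pow_eq_sum_words {R ι : Type*} [Semiring R] [Fintype ι] (X : ι → R) (p : ℕ) :
    (∑ i, X i) ^ p = ∑ f : Fin p → ι, (List.ofFn fun j => X (f j)).prod := by
  induction p with
  | zero => simp
  | succ p ih =>
    rw [pow_succ', ih, Finset.sum_mul_sum, ← (Fin.consEquiv fun _ => ι).sum_comp,
      Fintype.sum_prod_type]
    simp [Fin.consEquiv, List.ofFn_succ]

theorem norm_list_prod_le {n : Type*} [Fintype n] [DecidableEq n] {b : ℝ} (hb : 0 ≤ b)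
    (l : List (Matrix n n ℂ)) (hl : ∀ A ∈ l, ‖A‖ ≤ b) : ‖l.prod‖ ≤ b ^ l.length := by
  induction l with
  | nil =>
    rw [List.prod_nil, List.length_nil, pow_zero, Matrix.cstar_norm_def, map_one]
    exact ContinuousLinearMap.norm_id_le
  | cons A l ih =>
    rw [List.prod_cons, List.length_cons, pow_succ']
    refine (norm_mul_le _ _).trans ?_
    exact mul_le_mul (hl A List.mem_cons_self) (ih fun B hB => hl B (List.mem_cons_of_mem _ hB))
      (norm_nonneg _) hb

variable {ρs : C → Matrix (Fin d) (Fin d) ℂ} {W : Finset (Finset C)}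
  {X : Finset C → Matrix (C → Fin d) (C → Fin d) ℂ}

theorem expect_word_eq_zero (htr : ∀ s, (ρs s).trace = 1)
    (hsupp : ∀ w ∈ W, SupportedOn w (X w)) (hzero : ∀ w ∈ W, expect (prodMatrix ρs) (X w) = 0)
    {p : ℕ} (f : Fin p → W) (i : Fin p) (hi : ∀ j ≠ i, Disjoint (f j : Finset C) (f i)) :
    expect (prodMatrix ρs) (List.ofFn fun j => X (f j)).prod = 0 := by
  have hout : ∀ j ≠ i, X (f j) ∈ outsideAlgebra (d := d) (f i : Finset C) := fun j hj =>
    (hsupp _ (f j).2).mem_outsideAlgebra (hi j hj)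
  set l := List.ofFn fun j => X (f j) with hl
  have hlen : l.length = p := by simp [hl]
  have hil : (i : ℕ) < l.length := by rw [hlen]; exact i.2
  have htake : (l.take i).prod ∈ outsideAlgebra (d := d) (f i : Finset C) := by
    refine list_prod_mem fun A hA => ?_
    obtain ⟨j, hj, rfl⟩ := List.mem_take_iff_getElem.mp hA
    rw [lt_min_iff] at hj
    simp only [hl, List.getElem_ofFn]
    exact hout _ fun h => absurd (congrArg Fin.val h) hj.1.ne
  have hdrop : (l.drop (i + 1)).prod ∈ outsideAlgebra (d := d) (f i : Finset C) := by
    refine list_prod_mem fun A hA => ?_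
    obtain ⟨j, hj, rfl⟩ := List.mem_drop_iff_getElem.mp hA
    simp only [hl, List.getElem_ofFn]
    refine hout _ fun h => ?_
    have := congrArg Fin.val h
    simp only at this
    omega
  have hsplit : l.prod = X (f i) ^ 1 * ((l.take i).prod * (l.drop (i + 1)).prod) := by
    rw [pow_one, ← mul_assoc, ((hsupp _ (f i).2).commute htake).eq, mul_assoc]
    conv_lhs => rw [← List.take_append_drop i l, List.drop_eq_getElem_cons hil, List.prod_append,
      List.prod_cons]
    simp [hl]
  rw [hsplit, (hsupp _ (f i).2).expect_pow_mul htr (mul_mem htake hdrop), pow_one,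
    hzero _ (f i).2, zero_mul]

theorem norm_expect_sum_pow_le (hρs : ∀ s, (ρs s).PosSemidef ∧ (ρs s).trace = 1)
    (hsupp : ∀ w ∈ W, SupportedOn w (X w)) (hzero : ∀ w ∈ W, expect (prodMatrix ρs) (X w) = 0)
    (hnorm : ∀ w ∈ W, ‖X w‖ ≤ 2) {m : ℕ}
    (hm : ∀ w ∈ W, (W.filter fun v => ¬ Disjoint w v).card ≤ m) (r : ℕ) :
    ‖expect (prodMatrix ρs) ((∑ w ∈ W, X w) ^ (2 * r))‖ ≤
      r.centralBinom * (4 * (W.card * (r * m))) ^ r := by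
  have hpsd := posSemidef_prodMatrix fun s => (hρs s).1
  have htr : (prodMatrix ρs).trace = 1 := by simp [trace_prodMatrix, fun s => (hρs s).2]
  let R : W → W → Prop := fun a b => ¬ Disjoint (a : Finset C) b
  have : DecidableRel R := fun a b => inferInstanceAs (Decidable (¬ Disjoint (a : Finset C) b))
  have hcount := card_filter_no_isolated_le R (fun a b h h' => h h'.symm) (m := m)
    (fun a => by
      refine le_trans ?_ (hm a a.2)
      refine Finset.card_le_card_of_injOn (fun b => (b : Finset C)) ?_
        Subtype.val_injective.injOn
      intro b hb
      have := (Finset.mem_filter.mp (Finset.mem_coe.mp hb)).2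
      exact Finset.mem_coe.mpr (Finset.mem_filter.mpr ⟨b.2, this⟩)) r
  rw [Fintype.card_coe] at hcount
  rw [← Finset.sum_coe_sort, sum_pow_eq_sum_words, map_sum]
  rw [← Finset.sum_filter_of_ne
    (p := fun f : Fin (2 * r) → W => ∀ i, ∃ j, j ≠ i ∧ R (f i) (f j))]
  · refine (norm_sum_le_of_le _ (n := fun _ => (2 : ℝ) ^ (2 * r)) fun f _ => ?_).trans ?_
    · refine (norm_expect_le hpsd htr _).trans ?_
      refine (norm_list_prod_le zero_le_two _ ?_).trans (by simp)
      intro A hA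
      obtain ⟨j, rfl⟩ := (List.mem_ofFn' _ _).mp hA
      exact hnorm _ (f j).2
    · rw [Finset.sum_const, nsmul_eq_mul]
      calc _ ≤ ((r.centralBinom * (W.card * (r * m)) ^ r : ℕ) : ℝ) * 2 ^ (2 * r) := by
            gcongr
        _ = _ := by
            push_cast
            rw [pow_mul, mul_pow 4]
            norm_num
            ring
  · intro f _ hf
    by_contra! hno
    obtain ⟨i, hi⟩ := hno
    exact hf (expect_word_eq_zero (fun s => (hρs s).2) hsupp hzero f i fun j hj =>
      (not_not.mp (hi j hj)).symm)

end Moments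

section Tails

theorem two_mul_centralBinom_le {r : ℕ} (hr : 0 < r) : 2 * r.centralBinom ≤ 4 ^ r := by
  induction r, hr using Nat.le_induction with
  | base => simp [Nat.centralBinom, Nat.choose]
  | succ r hr ih =>
    have h := Nat.succ_mul_centralBinom_succ r
    have : (r + 1) * (2 * (r + 1).centralBinom) ≤ (r + 1) * 4 ^ (r + 1) := by
      calc (r + 1) * (2 * (r + 1).centralBinom) = 2 * (2 * r + 1) * (2 * r.centralBinom) := by
            linarith
        _ ≤ 2 * (2 * r + 1) * 4 ^ r := by gcongr
        _ ≤ (r + 1) * 4 ^ (r + 1) := by rw [pow_succ]; nlinarith [Nat.one_le_pow r 4 (by norm_num)]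
    exact Nat.le_of_mul_le_mul_left this (Nat.succ_pos r)

theorem exp_half_le_two : Real.exp (1 / 2) ≤ 2 := by
  rw [← Real.le_log_iff_exp_le (by norm_num)]
  linarith [Real.log_two_gt_d9]

/-- Optimising the moment bound over its order. -/
theorem exists_moment_order {K ε : ℝ} (hK : 0 < K) (hε : Real.sqrt (8 * Real.exp 1 * K) ≤ ε) :
    ∃ r : ℕ, r.centralBinom * (K * r) ^ r / ε ^ (2 * r) ≤
      Real.exp (-(ε ^ 2) / (4 * Real.exp 1 * K)) := by
  have he := Real.exp_pos 1
  obtain ⟨y, hy⟩ : ∃ y, y = ε ^ 2 / (4 * Real.exp 1 * K) := ⟨_, rfl⟩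
  have hεsq : 8 * Real.exp 1 * K ≤ ε ^ 2 := Real.sqrt_le_left
    ((Real.sqrt_nonneg _).trans hε) |>.mp hε
  have hε2 : ε ^ 2 = 4 * Real.exp 1 * K * y := by rw [hy]; field_simp
  have hy2 : 2 ≤ y := by
    rw [hy, le_div_iff₀ (by positivity)]; linarith
  have hy0 : 0 < y := by linarith
  refine ⟨⌈y⌉₊, ?_⟩
  have hr1 : y ≤ (⌈y⌉₊ : ℝ) := Nat.le_ceil y
  have hr2 : (⌈y⌉₊ : ℝ) < y + 1 := Nat.ceil_lt_add_one hy0.le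
  have hr0 : 0 < ⌈y⌉₊ := Nat.ceil_pos.mpr hy0
  set r := ⌈y⌉₊
  have hbinom : (r.centralBinom : ℝ) ≤ 4 ^ r / 2 := by
    have := two_mul_centralBinom_le hr0
    have : (2 : ℝ) * r.centralBinom ≤ 4 ^ r := by exact_mod_cast this
    linarith
  have hpow : ((r : ℝ) / y) ^ r ≤ Real.exp (r * (r / y - 1)) := by
    rw [Real.exp_nat_mul]
    gcongr
    linarith [Real.add_one_le_exp ((r : ℝ) / y - 1)]
  have hexpo : (r : ℝ) * (r / y - 1) - r ≤ -y + 1 / 2 := by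
    have h1 : (r : ℝ) * (r / y - 1) - r + y = (r - y) ^ 2 / y := by field_simp; ring
    have h2 : ((r : ℝ) - y) ^ 2 / y ≤ 1 / 2 := by
      rw [div_le_iff₀ hy0]
      nlinarith
    linarith
  calc r.centralBinom * (K * r) ^ r / ε ^ (2 * r)
      ≤ 4 ^ r / 2 * (K * r) ^ r / ε ^ (2 * r) := by
        rw [pow_mul]; gcongr
    _ = ((r : ℝ) / y) ^ r * Real.exp (-r) / 2 := by
        have : Real.exp (-(r : ℝ)) = (Real.exp 1)⁻¹ ^ r := by
          rw [← Real.exp_neg, ← Real.exp_nat_mul]; ring_nf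
        rw [this, pow_mul, hε2, ← mul_pow, div_mul_eq_mul_div, ← mul_pow, div_right_comm,
          ← div_pow]
        congr 2
        field_simp
    _ ≤ Real.exp (r * (r / y - 1)) * Real.exp (-r) / 2 := by gcongr
    _ = Real.exp (r * (r / y - 1) - r) / 2 := by rw [← Real.exp_add, ← sub_eq_add_neg]
    _ ≤ Real.exp (-y + 1 / 2) / 2 := by gcongr
    _ ≤ Real.exp (-y) := by
        rw [Real.exp_add]
        nlinarith [exp_half_le_two, Real.exp_pos (-y)]
    _ = _ := by rw [hy, neg_div]

variable {ι : Type*} [Fintype ι] {q μ : ι → ℝ}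

theorem sum_tail_le_moment_div (hq : ∀ i, 0 ≤ q i) {ε : ℝ} (hε : 0 < ε) (r : ℕ)
    (P : ι → Prop) [DecidablePred P] (hP : ∀ i, P i → ε ≤ |μ i|) :
    ∑ i, q i * (if P i then 1 else 0) ≤ (∑ i, q i * μ i ^ (2 * r)) / ε ^ (2 * r) := by
  rw [Finset.sum_div]
  refine Finset.sum_le_sum fun i _ => ?_
  rw [mul_div_assoc]
  refine mul_le_mul_of_nonneg_left ?_ (hq i)
  split_ifs with h
  · rw [one_le_div (by positivity), pow_mul, pow_mul, ← sq_abs (μ i)]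
    have := hP i h
    gcongr
  · exact div_nonneg ((even_two_mul r).pow_nonneg _) (by positivity)

theorem sum_tail_le_exp (hq : ∀ i, 0 ≤ q i) {ε t : ℝ} (P : ι → Prop) [DecidablePred P]
    (hP : ∀ i, P i → ε ≤ t * μ i) :
    ∑ i, q i * (if P i then 1 else 0) ≤ Real.exp (-ε) * ∑ i, q i * Real.exp (t * μ i) := by
  rw [Finset.mul_sum]
  refine Finset.sum_le_sum fun i _ => ?_
  rw [mul_left_comm]
  refine mul_le_mul_of_nonneg_left ?_ (hq i)
  rw [← Real.exp_add]
  split_ifs with h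
  · exact Real.one_le_exp (by linarith [hP i h])
  · positivity

theorem hasSum_exp_moments (q μ : ι → ℝ) (t : ℝ) :
    HasSum (fun p : ℕ => t ^ p / p.factorial * ∑ i, q i * μ i ^ p)
      (∑ i, q i * Real.exp (t * μ i)) := by
  simp only [Finset.mul_sum]
  refine hasSum_sum fun i _ => ?_
  have h := (NormedSpace.expSeries_div_hasSum_exp (t * μ i)).mul_left (q i)
  rw [← Real.exp_eq_exp_ℝ] at h
  refine h.congr_fun ?_
  intro p
  rw [mul_pow]
  ring

theorem sum_exp_eq_of_moments_eq {κ : Type*} [Fintype κ] {q' μ' : κ → ℝ}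
    (h : ∀ p : ℕ, ∑ i, q i * μ i ^ p = ∑ j, q' j * μ' j ^ p) (t : ℝ) :
    ∑ i, q i * Real.exp (t * μ i) = ∑ j, q' j * Real.exp (t * μ' j) := by
  refine (hasSum_exp_moments q μ t).unique ?_
  simpa only [h] using hasSum_exp_moments q' μ' t

theorem sum_exp_le_of_centered (hq : ∀ i, 0 ≤ q i) (h0 : ∑ i, q i = 1)
    (h1 : ∑ i, q i * μ i = 0) (h2 : ∑ i, q i * μ i ^ 2 ≤ 1) (hμ : ∀ i, |μ i| ≤ 2) {t : ℝ}
    (ht : |t| ≤ 1 / 2) : ∑ i, q i * Real.exp (t * μ i) ≤ Real.exp (t ^ 2) := by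
  have hpt : ∀ i, Real.exp (t * μ i) ≤ 1 + t * μ i + t ^ 2 * μ i ^ 2 := by
    intro i
    have : |t * μ i| ≤ 1 := by
      rw [abs_mul]; nlinarith [hμ i, abs_nonneg t, abs_nonneg (μ i)]
    have := (abs_le.mp (Real.abs_exp_sub_one_sub_id_le this)).2
    rw [mul_pow] at this
    linarith
  calc ∑ i, q i * Real.exp (t * μ i) ≤ ∑ i, q i * (1 + t * μ i + t ^ 2 * μ i ^ 2) :=
        Finset.sum_le_sum fun i _ => mul_le_mul_of_nonneg_left (hpt i) (hq i)
    _ = ∑ i, q i + t * ∑ i, q i * μ i + t ^ 2 * ∑ i, q i * μ i ^ 2 := by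
        simp only [Finset.mul_sum, ← Finset.sum_add_distrib]
        refine Finset.sum_congr rfl fun i _ => ?_
        ring
    _ ≤ t ^ 2 + 1 := by rw [h0, h1]; nlinarith [sq_nonneg t]
    _ ≤ Real.exp (t ^ 2) := Real.add_one_le_exp _

end Tails

section Disjoint

variable {ρs : C → Matrix (Fin d) (Fin d) ℂ}
  {X : Finset C → Matrix (C → Fin d) (C → Fin d) ℂ}

theorem expect_pow_eq (hρs : ∀ s, (ρs s).PosSemidef)
    {H : Matrix (C → Fin d) (C → Fin d) ℂ} (hH : H.IsHermitian) (p : ℕ) :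
    expect (prodMatrix ρs) (H ^ p) = ((∑ i, spectralWeight (prodMatrix ρs) hH i *
      hH.eigenvalues i ^ p : ℝ) : ℂ) := by
  simpa using expect_sub_smul_one_pow (posSemidef_prodMatrix hρs) hH 0 p

theorem sum_exp_le_of_disjoint (hρs : ∀ s, (ρs s).PosSemidef ∧ (ρs s).trace = 1)
    (S : Finset (Finset C)) (hdisj : (S : Set (Finset C)).PairwiseDisjoint id)
    (hsupp : ∀ w ∈ S, SupportedOn w (X w)) (hherm : ∀ w ∈ S, (X w).IsHermitian)
    (hzero : ∀ w ∈ S, expect (prodMatrix ρs) (X w) = 0) (hnorm : ∀ w ∈ S, ‖X w‖ ≤ 2)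
    (hvar : ∀ w ∈ S, (expect (prodMatrix ρs) (X w ^ 2)).re ≤ 1)
    {q μ : (C → Fin d) → ℝ}
    (hmom : ∀ p : ℕ, expect (prodMatrix ρs) ((∑ w ∈ S, X w) ^ p) =
      ((∑ i, q i * μ i ^ p : ℝ) : ℂ))
    {t : ℝ} (ht : |t| ≤ 1 / 2) :
    ∑ i, q i * Real.exp (t * μ i) ≤ Real.exp (t ^ 2 * S.card) := by
  have hpsd := posSemidef_prodMatrix fun s => (hρs s).1
  have htr : (prodMatrix ρs).trace = 1 := by simp [trace_prodMatrix, fun s => (hρs s).2]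
  induction S using Finset.induction_on generalizing q μ with
  | empty =>
    have h : ∀ p : ℕ, ∑ i, q i * μ i ^ p = ∑ _j : Unit, (1 : ℝ) * (0 : ℝ) ^ p := by
      intro p
      have h1 := hmom p
      rw [Finset.sum_empty] at h1
      rw [← Complex.ofReal_inj, ← h1]
      rcases p with _ | p
      · simp [expect_apply, htr]
      · simp
    rw [sum_exp_eq_of_moments_eq h]
    simp
  | insert w S hw ih =>
    have hYherm : (∑ v ∈ S, X v).IsHermitian := by
      have : IsSelfAdjoint (∑ v ∈ S, X v) := by
        rw [isSelfAdjoint_iff, star_sum]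
        exact Finset.sum_congr rfl fun v hv => hherm v (Finset.mem_insert_of_mem hv)
      exact this
    have hXherm := hherm w (Finset.mem_insert_self w S)
    have hXsupp := hsupp w (Finset.mem_insert_self w S)
    set Y := ∑ v ∈ S, X v with hY
    have hYout : Y ∈ outsideAlgebra (d := d) w := by
      refine sum_mem fun v hv => ?_
      refine (hsupp v (Finset.mem_insert_of_mem hv)).mem_outsideAlgebra ?_
      exact hdisj (Finset.mem_coe.mpr (Finset.mem_insert_of_mem hv))
        (Finset.mem_coe.mpr (Finset.mem_insert_self w S)) (by rintro rfl; exact hw hv)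
    have hXmom := expect_pow_eq (fun s => (hρs s).1) hXherm
    have hYmom := expect_pow_eq (fun s => (hρs s).1) hYherm
    have hYexp := ih (hdisj.subset (by simp)) (fun v hv => hsupp v (Finset.mem_insert_of_mem hv))
      (fun v hv => hherm v (Finset.mem_insert_of_mem hv))
      (fun v hv => hzero v (Finset.mem_insert_of_mem hv))
      (fun v hv => hnorm v (Finset.mem_insert_of_mem hv))
      (fun v hv => hvar v (Finset.mem_insert_of_mem hv)) hYmom
    set q₁ := spectralWeight (prodMatrix ρs) hXherm with hq₁
    set μ₁ := hXherm.eigenvalues with hμ₁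
    set q₂ := spectralWeight (prodMatrix ρs) hYherm with hq₂
    set μ₂ := hYherm.eigenvalues with hμ₂
    have hq₁0 : ∀ i, 0 ≤ q₁ i := spectralWeight_nonneg hpsd hXherm
    have hXexp : ∑ i, q₁ i * Real.exp (t * μ₁ i) ≤ Real.exp (t ^ 2) := by
      refine sum_exp_le_of_centered hq₁0 (sum_spectralWeight hpsd htr hXherm) ?_ ?_ ?_ ht
      · have h1 := hXmom 1
        rw [pow_one, hzero w (Finset.mem_insert_self w S)] at h1
        simpa using (Complex.ofReal_eq_zero.mp h1.symm)
      · have h2 := hvar w (Finset.mem_insert_self w S)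
        rwa [hXmom 2, Complex.ofReal_re] at h2
      · intro i
        have h3 := abs_eigenvalues_sub_le hXherm 0 i
        simp only [sub_zero, Complex.ofReal_zero, zero_smul] at h3
        exact h3.trans (hnorm w (Finset.mem_insert_self w S))
    have hprod : ∀ p : ℕ, ∑ i, q i * μ i ^ p =
        ∑ ij : (C → Fin d) × (C → Fin d), (q₁ ij.1 * q₂ ij.2) * (μ₁ ij.1 + μ₂ ij.2) ^ p := by
      intro p
      have h1 := hmom p
      rw [Finset.sum_insert hw, ← hY, (hXsupp.commute hYout).add_pow, map_sum] at h1
      have h2 : ∀ k ∈ Finset.range (p + 1),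
          expect (prodMatrix ρs) (X w ^ k * Y ^ (p - k) * (p.choose k : Matrix _ _ ℂ)) =
          (((∑ i, q₁ i * μ₁ i ^ k) * (∑ i, q₂ i * μ₂ i ^ (p - k)) * p.choose k : ℝ) : ℂ) := by
        intro k _
        rw [← nsmul_eq_mul', map_nsmul,
          hXsupp.expect_pow_mul (fun s => (hρs s).2) (pow_mem hYout _), hXmom, hYmom]
        push_cast
        rw [nsmul_eq_mul, mul_comm]
      rw [Finset.sum_congr rfl h2, ← Complex.ofReal_sum, Complex.ofReal_inj] at h1
      rw [← h1, Fintype.sum_prod_type]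
      simp only [Finset.sum_mul_sum]
      simp only [add_pow, Finset.sum_mul, Finset.mul_sum]
      rw [Finset.sum_comm]
      refine Finset.sum_congr rfl fun i _ => ?_
      rw [Finset.sum_comm]
      refine Finset.sum_congr rfl fun j _ => Finset.sum_congr rfl fun k _ => ?_
      ring
    rw [sum_exp_eq_of_moments_eq hprod, Fintype.sum_prod_type, Finset.card_insert_of_notMem hw]
    calc ∑ i, ∑ j, q₁ i * q₂ j * Real.exp (t * (μ₁ i + μ₂ j))
        = (∑ i, q₁ i * Real.exp (t * μ₁ i)) * ∑ j, q₂ j * Real.exp (t * μ₂ j) := by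
          rw [Finset.sum_mul_sum]
          refine Finset.sum_congr rfl fun i _ => Finset.sum_congr rfl fun j _ => ?_
          rw [mul_add, Real.exp_add]
          ring
      _ ≤ Real.exp (t ^ 2) * Real.exp (t ^ 2 * S.card) := by
          refine mul_le_mul hXexp hYexp ?_ (Real.exp_pos _).le
          exact Finset.sum_nonneg fun j _ =>
            mul_nonneg (spectralWeight_nonneg hpsd hYherm j) (Real.exp_pos _).le
      _ = _ := by rw [← Real.exp_add]; push_cast; ring_nf

end Disjoint

section Lattice

variable {W : Finset (Finset C)} {k g : ℕ}

theorem card_mul_le (hcard : ∀ w ∈ W, w.card = k)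
    (hg : ∀ s : C, (W.filter (fun w => s ∈ w)).card ≤ g) :
    W.card * k ≤ g * Fintype.card C := by
  calc W.card * k = ∑ w ∈ W, (Finset.univ.filter (· ∈ w)).card := by
        rw [Finset.sum_congr rfl fun w hw => by rw [Finset.filter_univ_mem, hcard w hw],
          Finset.sum_const, smul_eq_mul]
    _ = ∑ s : C, (W.filter (fun w => s ∈ w)).card :=
        Finset.sum_card_bipartiteAbove_eq_sum_card_bipartiteBelow (fun w s => s ∈ w)
    _ ≤ g * Fintype.card C := by
        refine (Finset.sum_le_card_nsmul _ _ g fun s _ => hg s).trans (le_of_eq ?_)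
        rw [smul_eq_mul, Finset.card_univ, mul_comm]

theorem card_filter_not_disjoint_le {C : Type*} [DecidableEq C] {W : Finset (Finset C)}
    (hcard : ∀ w ∈ W, w.card = k)
    (hg : ∀ s : C, (W.filter (fun w => s ∈ w)).card ≤ g) {w : Finset C} (hw : w ∈ W) :
    (W.filter fun v => ¬ Disjoint w v).card ≤ k * g := by
  have hsub : (W.filter fun v => ¬ Disjoint w v) ⊆ w.biUnion fun s => W.filter (s ∈ ·) := by
    intro v hv
    obtain ⟨hv, hwv⟩ := Finset.mem_filter.mp hv
    obtain ⟨s, hsw, hsv⟩ := Finset.not_disjoint_iff.mp hwv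
    exact Finset.mem_biUnion.mpr ⟨s, hsw, Finset.mem_filter.mpr ⟨hv, hsv⟩⟩
  refine (Finset.card_le_card hsub).trans (Finset.card_biUnion_le.trans ?_)
  refine (Finset.sum_le_card_nsmul _ _ g fun s _ => hg s).trans (le_of_eq ?_)
  rw [hcard w hw, smul_eq_mul]

theorem pairwiseDisjoint_of_mul_lt_four {C : Type*} [DecidableEq C] {W : Finset (Finset C)}
    (hk : 0 < k) (hcard : ∀ w ∈ W, w.card = k)
    (hg : ∀ s : C, (W.filter (fun w => s ∈ w)).card ≤ g) (hkg : k * g < 4) :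
    (W : Set (Finset C)).PairwiseDisjoint id := by
  intro v hv w hw hvw
  by_contra hdis
  obtain ⟨s, hsv, hsw⟩ := Finset.not_disjoint_iff.mp hdis
  have hg2 : 2 ≤ g := by
    refine le_trans ?_ (hg s)
    refine (Finset.card_pair hvw).symm.le.trans (Finset.card_le_card ?_)
    intro u hu
    rcases Finset.mem_insert.mp hu with rfl | hu
    · exact Finset.mem_filter.mpr ⟨hv, hsv⟩
    · rw [Finset.mem_singleton.mp hu]
      exact Finset.mem_filter.mpr ⟨hw, hsw⟩
  have hk1 : k = 1 := by nlinarith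
  obtain ⟨a, ha⟩ := Finset.card_eq_one.mp ((hcard v hv).trans hk1)
  obtain ⟨b, hb⟩ := Finset.card_eq_one.mp ((hcard w hw).trans hk1)
  rw [id, ha, Finset.mem_singleton] at hsv
  rw [id, hb, Finset.mem_singleton] at hsw
  exact hvw (by rw [ha, hb, ← hsv, ← hsw])

end Lattice

section Concentration

variable {ρs : C → Matrix (Fin d) (Fin d) ℂ} {W : Finset (Finset C)} {k g : ℕ}
  {X : Finset C → Matrix (C → Fin d) (C → Fin d) ℂ}

theorem sum_tail_le (hρs : ∀ s, (ρs s).PosSemidef ∧ (ρs s).trace = 1) (hk : 0 < k)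
    (hcard : ∀ w ∈ W, w.card = k) (hg : ∀ s : C, (W.filter (fun w => s ∈ w)).card ≤ g)
    (hsupp : ∀ w ∈ W, SupportedOn w (X w)) (hherm : ∀ w ∈ W, (X w).IsHermitian)
    (hzero : ∀ w ∈ W, expect (prodMatrix ρs) (X w) = 0) (hnorm : ∀ w ∈ W, ‖X w‖ ≤ 2)
    (hvar : ∀ w ∈ W, (expect (prodMatrix ρs) (X w ^ 2)).re ≤ 1)
    {q μ : (C → Fin d) → ℝ} (hq : ∀ i, 0 ≤ q i) (hsum : ∑ i, q i = 1)
    (hμ : ∀ i, |μ i| ≤ ‖∑ w ∈ W, X w‖)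
    (hmom : ∀ p : ℕ, expect (prodMatrix ρs) ((∑ w ∈ W, X w) ^ p) =
      ((∑ i, q i * μ i ^ p : ℝ) : ℂ))
    {K ε σ : ℝ} (hK : K = g ^ 3 * k * Fintype.card C)
    (hε : Real.sqrt (8 * Real.exp 1 * K) ≤ ε) (hσ : |σ| = 1)
    (P : (C → Fin d) → Prop) [DecidablePred P] (hP : ∀ i, P i → ε ≤ σ * μ i) :
    ∑ i, q i * (if P i then 1 else 0) ≤ Real.exp (-(ε ^ 2) / (4 * Real.exp 1 * K)) := by
  have hP' : ∀ i, P i → ε ≤ |μ i| := fun i hi => by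
    calc ε ≤ |σ * μ i| := (hP i hi).trans (le_abs_self _)
      _ = |μ i| := by rw [abs_mul, hσ, one_mul]
  have hK0 : 0 ≤ K := by rw [hK]; positivity
  rcases hK0.eq_or_lt with hK0 | hK0
  · rw [← hK0, mul_zero, div_zero, Real.exp_zero]
    refine (Finset.sum_le_sum fun i _ => mul_le_of_le_one_right (hq i) ?_).trans hsum.le
    split_ifs <;> norm_num
  have hg1 : 1 ≤ g := by
    by_contra! h
    rw [Nat.lt_one_iff.mp h] at hK
    simp [hK] at hK0
  have hKn : ((k * g : ℕ) : ℝ) ^ 2 * W.card ≤ K := by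
    have h : (W.card : ℝ) * k ≤ g * Fintype.card C := by exact_mod_cast card_mul_le hcard hg
    have h1 : (k : ℝ) * g ^ 2 * (W.card * k) ≤ k * g ^ 2 * (g * Fintype.card C) := by gcongr
    rw [hK]
    push_cast
    linarith
  have hε0 : 0 < ε := lt_of_lt_of_le (by positivity) hε
  have he := Real.exp_pos 1
  rcases le_or_gt 4 (k * g) with hkg | hkg
  · obtain ⟨r, hr⟩ := exists_moment_order hK0 hε
    refine (sum_tail_le_moment_div hq hε0 r P hP').trans (le_trans ?_ hr)
    gcongr
    have h := norm_expect_sum_pow_le hρs hsupp hzero hnorm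
      (fun w hw => card_filter_not_disjoint_le hcard hg hw) r
    rw [hmom, Complex.norm_real] at h
    have h4 : (4 : ℝ) ≤ (k * g : ℕ) := by exact_mod_cast hkg
    have h5 : (4 : ℝ) * (W.card * (k * g : ℕ)) ≤ K := by
      refine le_trans ?_ hKn
      calc (4 : ℝ) * (W.card * (k * g : ℕ)) ≤ (k * g : ℕ) * (W.card * (k * g : ℕ)) := by gcongr
        _ = _ := by ring
    have h6 : (4 : ℝ) * (W.card * (r * (k * g : ℕ))) ≤ K * r := by
      calc (4 : ℝ) * (W.card * (r * (k * g : ℕ))) = 4 * (W.card * (k * g : ℕ)) * r := by ring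
        _ ≤ K * r := by gcongr
    refine (Real.le_norm_self _).trans (h.trans ?_)
    exact mul_le_mul_of_nonneg_left (pow_le_pow_left₀ (by positivity) h6 r) (Nat.cast_nonneg _)
  · have hn : (W.card : ℝ) ≤ K := by
      refine le_trans ?_ hKn
      have : (1 : ℝ) ≤ (k * g : ℕ) := by exact_mod_cast Nat.mul_pos hk hg1
      exact le_mul_of_one_le_left (Nat.cast_nonneg _) (one_le_pow₀ this)
    rcases le_or_gt ε (2 * K) with hεK | hεK
    · have hs : |σ * (ε / (4 * K))| ≤ 1 / 2 := by
        rw [abs_mul, hσ, one_mul, abs_of_pos (by positivity), div_le_iff₀ (by positivity)]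
        linarith
      have hσ2 : σ ^ 2 = 1 := by rw [← sq_abs, hσ, one_pow]
      have hexp := sum_exp_le_of_disjoint hρs W (pairwiseDisjoint_of_mul_lt_four hk hcard hg hkg)
        hsupp hherm hzero hnorm hvar hmom hs
      have htail := sum_tail_le_exp (μ := μ) hq (ε := ε / (4 * K) * ε)
        (t := σ * (ε / (4 * K))) P fun i hi => by
          have : 0 ≤ ε / (4 * K) := by positivity
          nlinarith [hP i hi]
      refine htail.trans ((mul_le_mul_of_nonneg_left hexp (Real.exp_pos _).le).trans ?_)
      rw [← Real.exp_add, Real.exp_le_exp, mul_pow, hσ2, one_mul]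
      have h1 : (ε / (4 * K)) ^ 2 * W.card ≤ (ε / (4 * K)) ^ 2 * K := by gcongr
      have h2 : -(ε / (4 * K) * ε) + (ε / (4 * K)) ^ 2 * K = -(ε ^ 2 / K) * (3 / 16) := by
        field_simp
        ring
      have h3 : -(ε ^ 2) / (4 * Real.exp 1 * K) = -(ε ^ 2 / K) * (1 / (4 * Real.exp 1)) := by
        field_simp
      have h4 : 1 / (4 * Real.exp 1) ≤ 3 / 16 := by
        rw [div_le_iff₀ (by positivity)]
        linarith [Real.exp_one_gt_d9]
      have h5 : 0 ≤ ε ^ 2 / K := by positivity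
      rw [h3]
      nlinarith
    · refine le_of_eq_of_le (Finset.sum_eq_zero fun i _ => ?_) (Real.exp_pos _).le
      have hXn : ‖∑ w ∈ W, X w‖ ≤ W.card * 2 := by
        simpa using norm_sum_le_of_le W hnorm
      rw [if_neg fun hi => ?_, mul_zero]
      linarith [hP' i hi, hμ i]

end Concentration

section Centering

variable {n : Type*} [Fintype n] [DecidableEq n] {ρ M : Matrix n n ℂ}

/-- The fluctuation of the observable `M` around its mean in the state `ρ`. -/
noncomputable def fluctuation (ρ M : Matrix n n ℂ) : Matrix n n ℂ :=
  M - ((expect ρ M).re : ℂ) • (1 : Matrix n n ℂ)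

theorem isHermitian_fluctuation (hM : M.IsHermitian) : (fluctuation ρ M).IsHermitian := by
  rw [fluctuation, Matrix.IsHermitian, Matrix.conjTranspose_sub, hM.eq,
    Matrix.conjTranspose_smul, Matrix.conjTranspose_one]
  simp

theorem ofReal_re_expect (hρ : ρ.IsHermitian) (hM : M.IsHermitian) :
    ((expect ρ M).re : ℂ) = expect ρ M :=
  Complex.ext rfl (expect_im_eq_zero hρ hM).symm

theorem expect_fluctuation (hρ : ρ.IsHermitian) (htr : ρ.trace = 1) (hM : M.IsHermitian) :
    expect ρ (fluctuation ρ M) = 0 := by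
  rw [fluctuation, map_sub, map_smul, ofReal_re_expect hρ hM, expect_apply ρ 1, mul_one, htr,
    smul_eq_mul, mul_one, sub_self]

theorem norm_fluctuation_le (hρ : ρ.PosSemidef) (htr : ρ.trace = 1) (hM : opNorm M ≤ 1) :
    ‖fluctuation ρ M‖ ≤ 2 := by
  replace hM : ‖M‖ ≤ 1 := hM
  have h1 : ‖(1 : Matrix n n ℂ)‖ ≤ 1 := by
    simpa using norm_list_prod_le (n := n) zero_le_one [] (by simp)
  have h2 : |(expect ρ M).re| ≤ 1 :=
    (Complex.abs_re_le_norm _).trans ((norm_expect_le hρ htr M).trans hM)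
  refine (norm_sub_le _ _).trans ?_
  rw [norm_smul, Complex.norm_real, Real.norm_eq_abs]
  nlinarith [norm_nonneg (1 : Matrix n n ℂ), abs_nonneg (expect ρ M).re]

theorem re_expect_fluctuation_sq_le (hρ : ρ.PosSemidef) (htr : ρ.trace = 1) (hM : opNorm M ≤ 1) :
    (expect ρ (fluctuation ρ M ^ 2)).re ≤ 1 := by
  replace hM : ‖M‖ ≤ 1 := hM
  set c := (expect ρ M).re with hc
  have h1 : fluctuation ρ M ^ 2 = M ^ 2 - ((2 * c : ℝ) : ℂ) • M + ((c ^ 2 : ℝ) : ℂ) • 1 := by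
    rw [fluctuation, ← hc, sq, sub_mul, mul_sub, mul_sub, smul_mul_assoc, mul_smul_comm,
      one_mul, mul_one, smul_mul_smul_comm, mul_one, sq]
    push_cast
    module
  have h2 : (expect ρ (M ^ 2)).re ≤ 1 := by
    refine (Complex.re_le_norm _).trans ((norm_expect_le hρ htr _).trans ?_)
    rw [sq]
    exact (norm_mul_le _ _).trans (mul_le_one₀ hM (norm_nonneg _) hM)
  rw [h1, map_add, map_sub, map_smul, map_smul, expect_apply ρ 1, mul_one, htr, smul_eq_mul,
    smul_eq_mul, mul_one, Complex.add_re, Complex.sub_re, Complex.re_ofReal_mul,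
    Complex.ofReal_re, ← hc]
  nlinarith [sq_nonneg c]

end Centering

end ProductState

/-- Corollary 5.4: if each local term is supported on exactly `k` spins, each
of the `N` spins lies in the support of at most `g` local terms, and `ρ` is a
product state, then for `ε ≥ √(8eg³kN)` both tails of the energy distribution
of `ρ` are bounded by `exp(−ε²/(4eg³kN))`. -/
theorem product_state_tails_spin_count {C : Type*} [Fintype C] [DecidableEq C] {d : ℕ}
    (N : ℕ) (hN : Fintype.card C = N)
    (W : Finset (Finset C)) (k g : ℕ) (hk : 0 < k)
    (hcard : ∀ w ∈ W, w.card = k)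
    (hg : ∀ s : C, (W.filter (fun w => s ∈ w)).card ≤ g)
    (h : Finset C → Matrix (C → Fin d) (C → Fin d) ℂ)
    (hsupp : ∀ w ∈ W, SupportedOn w (h w))
    (hherm : ∀ w ∈ W, (h w).IsHermitian)
    (hnorm : ∀ w ∈ W, opNorm (h w) ≤ 1)
    (ρs : C → Matrix (Fin d) (Fin d) ℂ)
    (hρs : ∀ s, (ρs s).PosSemidef ∧ (ρs s).trace = 1)
    (hH : (∑ w ∈ W, h w).IsHermitian)
    (ε : ℝ) (hε : Real.sqrt (8 * Real.exp 1 * g ^ 3 * k * N) ≤ ε) :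
    (Matrix.trace (prodMatrix ρs *
        projGE hH ((Matrix.trace (prodMatrix ρs * ∑ w ∈ W, h w)).re + ε))).re ≤
        Real.exp (-(ε ^ 2) / (4 * Real.exp 1 * g ^ 3 * k * N)) ∧
      (Matrix.trace (prodMatrix ρs *
        projLE hH ((Matrix.trace (prodMatrix ρs * ∑ w ∈ W, h w)).re - ε))).re ≤
        Real.exp (-(ε ^ 2) / (4 * Real.exp 1 * g ^ 3 * k * N)) := by
  subst hN
  have hpsd := posSemidef_prodMatrix fun s => (hρs s).1
  have htr : (prodMatrix ρs).trace = 1 := by simp [trace_prodMatrix, fun s => (hρs s).2]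
  set ρ := prodMatrix ρs with hρ
  set c := (Matrix.trace (ρ * ∑ w ∈ W, h w)).re with hc
  have hfluct : ∑ w ∈ W, fluctuation ρ (h w) = ∑ w ∈ W, h w - (c : ℂ) • 1 := by
    have : c = ∑ w ∈ W, (expect ρ (h w)).re := by
      rw [hc, ← expect_apply, map_sum, Complex.re_sum]
    rw [this, Complex.ofReal_sum, Finset.sum_smul, ← Finset.sum_sub_distrib]
    rfl
  have key : ∀ σ : ℝ, |σ| = 1 → ∀ (P : (C → Fin d) → Prop) [DecidablePred P],
      (∀ i, P i → ε ≤ σ * (hH.eigenvalues i - c)) →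
      ∑ i, spectralWeight ρ hH i * (if P i then 1 else 0) ≤
        Real.exp (-(ε ^ 2) / (4 * Real.exp 1 * g ^ 3 * k * Fintype.card C)) := by
    intro σ hσ P _ hP
    have hassoc : ∀ a : ℝ, a * g ^ 3 * k * Fintype.card C =
        a * (g ^ 3 * k * Fintype.card C) := fun a => by ring
    rw [hassoc]
    rw [hassoc] at hε
    refine sum_tail_le (X := fun w => fluctuation ρ (h w)) (μ := fun i => hH.eigenvalues i - c)
      hρs hk hcard hg (fun w hw => (hsupp w hw).sub_smul_one _)
      (fun w hw => isHermitian_fluctuation (hherm w hw))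
      (fun w hw => expect_fluctuation hpsd.1 htr (hherm w hw))
      (fun w hw => norm_fluctuation_le hpsd htr (hnorm w hw))
      (fun w hw => re_expect_fluctuation_sq_le hpsd htr (hnorm w hw))
      (spectralWeight_nonneg hpsd hH) (sum_spectralWeight hpsd htr hH) ?_ ?_ rfl hε hσ P hP
    · intro i
      rw [hfluct]
      exact abs_eigenvalues_sub_le hH c i
    · intro p
      rw [hfluct]
      exact expect_sub_smul_one_pow hpsd hH c p
  rw [trace_mul_projGE hpsd hH, trace_mul_projLE hpsd hH]
  refine ⟨key 1 (by simp) _ fun i hi => ?_, key (-1) (by simp) _ fun i hi => ?_⟩ <;> linarith
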